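/- Let H₁ and H₂ be closed subspaces of a real Hilbert space H with ρ₀ = ρ₀(H₁, H₂) < 1. Let Π, Π₁, Π₂ denote the orthogonal projections onto H₁ + H₂, H₁, H₂ respectively, and for v ∈ H write Πv = (Πv)₁ + (Πv)₂ with (Πv)₁ ∈ H₁ and (Πv)₂ ∈ H₂. Then ‖(Πv)₁‖ ≤ (1 / (1 − ρ₀²)) ‖Π₁(v − Π₂v)‖ for every v ∈ H. -/

import Mathlib

open scoped RealInnerProductSpace

/-- The cosine of the minimal angle between two subspaces of a real inner product space. -/
noncomputable def rho0 {H : Type*} [NormedAddCommGroup H] [InnerProductSpace ℝ H]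
    (H₁ H₂ : Submodule ℝ H) : ℝ :=
  sSup {r : ℝ | ∃ h₁ ∈ H₁, ∃ h₂ ∈ H₂, h₁ ≠ 0 ∧ h₂ ≠ 0 ∧ r = ⟪h₁, h₂⟫ / (‖h₁‖ * ‖h₂‖)}

lemma rho0_nonneg {H : Type*} [NormedAddCommGroup H] [InnerProductSpace ℝ H]
    (H₁ H₂ : Submodule ℝ H) : 0 ≤ rho0 H₁ H₂ := by
  unfold rho0
  by_cases hne : ∃ h₁ ∈ H₁, ∃ h₂ ∈ H₂, h₁ ≠ 0 ∧ h₂ ≠ 0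
  · obtain ⟨a, ha, b, hb, ha0, hb0⟩ := hne
    refine Real.sSup_nonneg' ?_
    rcases le_total 0 ⟪a, b⟫ with h | h
    · exact ⟨_, ⟨a, ha, b, hb, ha0, hb0, rfl⟩, by positivity⟩
    · refine ⟨_, ⟨-a, H₁.neg_mem ha, b, hb, neg_ne_zero.mpr ha0, hb0, rfl⟩, ?_⟩
      rw [inner_neg_left]
      exact div_nonneg (neg_nonneg.mpr h) (by positivity)
  · refine Real.sSup_nonneg ?_
    rintro r ⟨a, ha, b, hb, ha0, hb0, -⟩
    exact absurd ⟨a, ha, b, hb, ha0, hb0⟩ hne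

lemma inner_le_rho0_mul {H : Type*} [NormedAddCommGroup H] [InnerProductSpace ℝ H]
    {H₁ H₂ : Submodule ℝ H} {a b : H} (ha : a ∈ H₁) (hb : b ∈ H₂) :
    ⟪a, b⟫ ≤ rho0 H₁ H₂ * (‖a‖ * ‖b‖) := by
  rcases eq_or_ne a 0 with rfl | ha0
  · simp
  rcases eq_or_ne b 0 with rfl | hb0
  · simp
  have hpos : 0 < ‖a‖ * ‖b‖ := by positivity
  rw [← div_le_iff₀ hpos]
  refine le_csSup ⟨1, ?_⟩ ⟨a, ha, b, hb, ha0, hb0, rfl⟩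
  rintro r ⟨x, -, y, -, -, -, rfl⟩
  exact div_le_one_of_le₀ (real_inner_le_norm x y) (by positivity)

/-- If `q ∈ H₂` is the orthogonal projection of `g ∈ H₁` onto `H₂`, then `‖q‖ ≤ ρ₀ ‖g‖`. -/
lemma norm_le_rho0_mul_of_sub_mem_orthogonal {H : Type*} [NormedAddCommGroup H]
    [InnerProductSpace ℝ H] {H₁ H₂ : Submodule ℝ H} {g q : H} (hg : g ∈ H₁) (hq : q ∈ H₂)
    (hgq : g - q ∈ H₂ᗮ) : ‖q‖ ≤ rho0 H₁ H₂ * ‖g‖ := by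
  rcases eq_or_ne q 0 with rfl | hq0
  · simpa using mul_nonneg (rho0_nonneg H₁ H₂) (norm_nonneg g)
  have h := Submodule.inner_left_of_mem_orthogonal hq hgq
  rw [inner_sub_left, real_inner_self_eq_norm_sq] at h
  have hle := inner_le_rho0_mul hg hq
  have hpos : 0 < ‖q‖ := norm_pos_iff.mpr hq0
  refine le_of_mul_le_mul_right ?_ hpos
  linarith

/-- If `ρ₀ = ρ₀(H₁,H₂) < 1` and `Πv = g₁ + g₂` is the unique decomposition of the
projection of `v` onto `H₁ + H₂`, then `‖g₁‖ ≤ (1/(1 - ρ₀²)) ‖Π₁(v - Π₂ v)‖`. -/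
theorem stmt4 {H : Type*} [NormedAddCommGroup H] [InnerProductSpace ℝ H] [CompleteSpace H]
    (H₁ H₂ : Submodule ℝ H) (hc₁ : IsClosed (H₁ : Set H)) (hc₂ : IsClosed (H₂ : Set H))
    (hρ : rho0 H₁ H₂ < 1)
    (P P₁ P₂ : H →L[ℝ] H)
    (hP : ∀ x : H, P x ∈ H₁ ⊔ H₂ ∧ x - P x ∈ (H₁ ⊔ H₂ : Submodule ℝ H)ᗮ)
    (hP₁ : ∀ x : H, P₁ x ∈ H₁ ∧ x - P₁ x ∈ H₁ᗮ)
    (hP₂ : ∀ x : H, P₂ x ∈ H₂ ∧ x - P₂ x ∈ H₂ᗮ)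
    (v g₁ g₂ : H) (hg₁ : g₁ ∈ H₁) (hg₂ : g₂ ∈ H₂) (hdec : P v = g₁ + g₂) :
    ‖g₁‖ ≤ 1 / (1 - rho0 H₁ H₂ ^ 2) * ‖P₁ (v - P₂ v)‖ := by
  have hρ0 := rho0_nonneg H₁ H₂
  have hpos : 0 < 1 - rho0 H₁ H₂ ^ 2 := by nlinarith
  set q := P₂ v - g₂ with hq
  have hqm : q ∈ H₂ := H₂.sub_mem (hP₂ v).1 hg₂
  have hv₁ : v - P v ∈ H₁ᗮ := Submodule.orthogonal_le le_sup_left (hP v).2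
  have hv₂ : v - P v ∈ H₂ᗮ := Submodule.orthogonal_le le_sup_right (hP v).2
  have hgq : g₁ - q ∈ H₂ᗮ := by
    have h : g₁ - q = (v - P₂ v) - (v - P v) := by rw [hdec, hq]; abel
    rw [h]
    exact H₂ᗮ.sub_mem (hP₂ v).2 hv₂
  have hqn := norm_le_rho0_mul_of_sub_mem_orthogonal hg₁ hqm hgq
  have hinner : ⟪g₁, P₁ (v - P₂ v)⟫ = ‖g₁‖ ^ 2 - ‖q‖ ^ 2 := by
    have h₁ := Submodule.inner_right_of_mem_orthogonal hg₁ (hP₁ (v - P₂ v)).2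
    have h₂ := Submodule.inner_right_of_mem_orthogonal hg₁ hv₁
    have h₃ := Submodule.inner_left_of_mem_orthogonal hqm hgq
    have h : v - P₂ v = (v - P v) + (g₁ - q) := by rw [hdec, hq]; abel
    rw [inner_sub_right] at h₁
    rw [← sub_eq_zero.mp h₁, h, inner_add_right, h₂, inner_sub_right]
    rw [inner_sub_left, real_inner_self_eq_norm_sq] at h₃
    rw [real_inner_self_eq_norm_sq]
    linarith
  have hcs := real_inner_le_norm g₁ (P₁ (v - P₂ v))
  have hsq : ‖q‖ ^ 2 ≤ rho0 H₁ H₂ ^ 2 * ‖g₁‖ ^ 2 := by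
    rw [← mul_pow]
    exact pow_le_pow_left₀ (norm_nonneg q) hqn 2
  rw [one_div, inv_mul_eq_div, le_div_iff₀ hpos]
  rcases (norm_nonneg g₁).eq_or_lt with h0 | h0
  · rw [← h0, zero_mul]
    exact norm_nonneg _
  · refine le_of_mul_le_mul_left ?_ h0
    linarith
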